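/- Let m be an even positive integer such that q = 2m² + 2m + 1 is a prime power. Let χ₄ be a multiplicative character of F_{q²} with χ₄(ω) = i, and suppose ε, δ ∈ {1, −1} satisfy G_q(η)·G_{q²}(χ₄)/q = ε(m+1) + δm·i in ℂ. Let h ∈ {0,1,2,3} and let ℓ be an integer with χ₄(ω^ℓ) = i^{3+h} and χ₄(ω^{ℓq} − ω^ℓ) = i^{δ(1+2h)}. Set (H₀, H₁) := ({h, h+1}, {h+1, h+2}) if εδ = 1 and (H₀, H₁) := ({h+1, h+2}, {h, h+1}) if εδ = −1, with elements reduced modulo 4, and for d = 0, 1 define D_d := {x ∈ F_q : 1 + x·ω^ℓ ∈ ⋃_{j∈H_d} C_j^{(4,q²)}}. Then |D₀| = m², |D₁| = m² + m + 1, { |D₀ ∩ ((C_0^{(2,q)}∪{0}) + s)| + |D₁ ∩ (C_0^{(2,q)} + s)| : s ∈ F_q } = {m², m²+1, m²+m+1, m²+m+2}, and { |D₀ ∩ (C_0^{(2,q)} + s)| + |D₁ ∩ ((F_q∖(C_0^{(2,q)}∪{0})) + s)| : s ∈ F_q } = {m², m²+m}. -/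

import Mathlib

noncomputable section

open Complex

open scoped Classical

open Classical in
/-- The quadratic character of a finite field, with values in `ℂ`. -/
noncomputable def quadChar (F : Type*) [Field F] : F → ℂ :=
  fun x => if x = 0 then 0 else if IsSquare x then 1 else -1

/-- The `i`-th cyclotomic class `C_i^{(e,q²)} = ω^i ⟨ω^e⟩` of order `e`. -/
def cyc {F2 : Type*} [Field F2] (ω : F2ˣ) (e : ℕ) (i : ℤ) : Set F2 :=
  {x | ∃ k : ℤ, x = ((ω ^ (i + (e : ℤ) * k) : F2ˣ) : F2)}

lemma ncard_sum {F : Type} [Fintype F] (X : Set F) :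
    (X.ncard : ℤ) = ∑ x : F, if x ∈ X then (1:ℤ) else 0 := by
  rw [Set.ncard_eq_toFinset_card', Finset.sum_boole, Set.filter_mem_univ_eq_toFinset]

set_option maxHeartbeats 1000000 in
lemma comb {F : Type} [Field F] [Fintype F] (m : ℕ) (hm : 0 < m)
    (hchar : ringChar F ≠ 2) (hcard : Fintype.card F = 2 * m ^ 2 + 2 * m + 1)
    (a b : F → ℤ)
    (hab : ∀ x, (a x = 1 ∧ b x = 0) ∨ (a x = 0 ∧ b x = 1) ∨ (a x = -1 ∧ b x = 0) ∨
      (a x = 0 ∧ b x = -1))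
    (hSa : ∑ x, a x = -(m + 1)) (hSb : ∑ x, b x = -m)
    (hSab : ∑ x, (a x ^ 2 - b x ^ 2) = 1)
    (hTa : ∀ s, ∑ x, a x * quadraticChar F (x - s) = -m * a s + (m + 1) * b s)
    (hTb : ∀ s, ∑ x, b x * quadraticChar F (x - s) = (m + 1) * a s + m * b s + 1)
    (C₀ : Set F) (hC₀ : C₀ = {x : F | x ≠ 0 ∧ IsSquare x}) (D₀ D₁ : Set F)
    (hD₀ : ∀ x, x ∈ D₀ ↔ a x = 1 ∨ b x = 1) (hD₁ : ∀ x, x ∈ D₁ ↔ a x = -1 ∨ b x = 1) :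
    D₀.ncard = m ^ 2 ∧ D₁.ncard = m ^ 2 + m + 1 ∧
      (Set.range fun s : F =>
          (D₀ ∩ ((fun x => x + s) '' (C₀ ∪ {0}))).ncard +
            (D₁ ∩ ((fun x => x + s) '' C₀)).ncard) =
        ({m ^ 2, m ^ 2 + 1, m ^ 2 + m + 1, m ^ 2 + m + 2} : Set ℕ) ∧
      (Set.range fun s : F =>
          (D₀ ∩ ((fun x => x + s) '' C₀)).ncard +
            (D₁ ∩ ((fun x => x + s) '' (Set.univ \ (C₀ ∪ {0})))).ncard) =
        ({m ^ 2, m ^ 2 + m} : Set ℕ) := by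
  have hI0 : ∀ x, 2 * (if x ∈ D₀ then (1:ℤ) else 0) = 1 + a x + b x := by
    intro x
    rw [if_congr (hD₀ x) rfl rfl]
    rcases hab x with ⟨h1, h2⟩ | ⟨h1, h2⟩ | ⟨h1, h2⟩ | ⟨h1, h2⟩ <;> simp [h1, h2]
  have hI1 : ∀ x, 2 * (if x ∈ D₁ then (1:ℤ) else 0) = 1 - a x + b x := by
    intro x
    rw [if_congr (hD₁ x) rfl rfl]
    rcases hab x with ⟨h1, h2⟩ | ⟨h1, h2⟩ | ⟨h1, h2⟩ | ⟨h1, h2⟩ <;> simp [h1, h2]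
  have hone : ∑ x : F, (1:ℤ) = 2 * m ^ 2 + 2 * m + 1 := by
    simp [hcard]
  have hc0 : (D₀.ncard : ℤ) = m ^ 2 := by
    have : 2 * (D₀.ncard : ℤ) = 2 * m ^ 2 := by
      rw [ncard_sum, Finset.mul_sum, Finset.sum_congr rfl (fun x _ => hI0 x),
        Finset.sum_add_distrib, Finset.sum_add_distrib, hone, hSa, hSb]
      ring
    linarith
  have hc1 : (D₁.ncard : ℤ) = m ^ 2 + m + 1 := by
    have : 2 * (D₁.ncard : ℤ) = 2 * (m ^ 2 + m + 1) := by
      rw [ncard_sum, Finset.mul_sum, Finset.sum_congr rfl (fun x _ => hI1 x),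
        Finset.sum_add_distrib, Finset.sum_sub_distrib, hone, hSa, hSb]
      ring
    linarith
  have hC : ∀ y, y ∈ C₀ ↔ quadraticChar F y = 1 := by
    intro y
    rw [hC₀]
    by_cases hy : y = 0
    · simp [hy]
    · rw [quadraticChar_one_iff_isSquare hy]
      simp [hy]
  have hi : ∀ (X : Set F) (s x : F), x ∈ (fun x => x + s) '' X ↔ x - s ∈ X := by
    intro X s x
    constructor
    · rintro ⟨y, hy, rfl⟩
      simpa using hy
    · intro h
      exact ⟨x - s, h, by simp⟩
  have htri : ∀ s x : F, (x = s ∧ quadraticChar F (x - s) = 0) ∨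
      (x ≠ s ∧ quadraticChar F (x - s) = 1) ∨ (x ≠ s ∧ quadraticChar F (x - s) = -1) := by
    intro s x
    by_cases h : x = s
    · left; simp [h]
    · right
      rcases quadraticChar_dichotomy (sub_ne_zero.mpr h) with h1 | h1 <;> simp [h, h1]
  have hP : ∀ s x, 2 * (if x ∈ (fun x => x + s) '' C₀ then (1:ℤ) else 0) =
      1 + quadraticChar F (x - s) - (if x = s then 1 else 0) := by
    intro s x
    rw [if_congr ((hi _ _ _).trans (hC _)) rfl rfl]
    rcases htri s x with ⟨h1, h2⟩ | ⟨h1, h2⟩ | ⟨h1, h2⟩ <;> rw [h2] <;> simp [h1]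
  have hP0 : ∀ s x, 2 * (if x ∈ (fun x => x + s) '' (C₀ ∪ {0}) then (1:ℤ) else 0) =
      1 + quadraticChar F (x - s) + (if x = s then 1 else 0) := by
    intro s x
    have : x ∈ (fun x => x + s) '' (C₀ ∪ {0}) ↔ quadraticChar F (x - s) = 1 ∨ x = s := by
      rw [hi, Set.mem_union, hC, Set.mem_singleton_iff, sub_eq_zero]
    rw [if_congr this rfl rfl]
    rcases htri s x with ⟨h1, h2⟩ | ⟨h1, h2⟩ | ⟨h1, h2⟩ <;> rw [h2] <;> simp [h1]
  have hN : ∀ s x, 2 * (if x ∈ (fun x => x + s) '' (Set.univ \ (C₀ ∪ {0})) then (1:ℤ) else 0) =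
      1 - quadraticChar F (x - s) - (if x = s then 1 else 0) := by
    intro s x
    have : x ∈ (fun x => x + s) '' (Set.univ \ (C₀ ∪ {0})) ↔
        ¬ (quadraticChar F (x - s) = 1 ∨ x = s) := by
      rw [hi, Set.mem_sdiff, Set.mem_union, hC, Set.mem_singleton_iff, sub_eq_zero]
      simp
    rw [if_congr this rfl rfl]
    rcases htri s x with ⟨h1, h2⟩ | ⟨h1, h2⟩ | ⟨h1, h2⟩ <;> rw [h2] <;> simp [h1]
  have hint : ∀ (X Y : Set F), (4:ℤ) * ((X ∩ Y).ncard : ℤ) =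
      ∑ x, (2 * (if x ∈ X then (1:ℤ) else 0)) * (2 * (if x ∈ Y then (1:ℤ) else 0)) := by
    intro X Y
    rw [ncard_sum, Finset.mul_sum]
    refine Finset.sum_congr rfl fun x _ => ?_
    by_cases h1 : x ∈ X <;> by_cases h2 : x ∈ Y <;> simp [h1, h2]
  have hTe : ∀ s : F, ∑ x, quadraticChar F (x - s) = 0 := by
    intro s
    rw [← quadraticChar_sum_zero hchar]
    exact Fintype.sum_equiv (Equiv.subRight s) _ _ fun x => rfl
  have hdel : ∀ (f : F → ℤ) (s : F), ∑ x, f x * (if x = s then 1 else 0) = f s := by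
    intro f s
    simp
  have hdel1 : ∀ (s : F), ∑ x, (if x = s then (1:ℤ) else 0) = 1 := by
    intro s
    simp
  have hN1 : ∀ s, (4:ℤ) * (((D₀ ∩ ((fun x => x + s) '' (C₀ ∪ {0}))).ncard : ℤ) +
      ((D₁ ∩ ((fun x => x + s) '' C₀)).ncard : ℤ)) =
      2 * (2 * m ^ 2 + m + 1) + 2 * ((m + 1) * a s + m * b s + 1) + 2 * a s := by
    intro s
    rw [mul_add, hint, hint, ← Finset.sum_add_distrib]
    simp only [hI0, hI1, hP, hP0]
    have : ∀ x, (1 + a x + b x) * (1 + quadraticChar F (x - s) + (if x = s then 1 else 0)) +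
        (1 - a x + b x) * (1 + quadraticChar F (x - s) - (if x = s then 1 else 0)) =
        2 * 1 + 2 * b x + 2 * quadraticChar F (x - s) + 2 * (b x * quadraticChar F (x - s)) +
        2 * (a x * (if x = s then 1 else 0)) := by
      intro x; ring
    rw [Finset.sum_congr rfl fun x _ => this x]
    simp only [Finset.sum_add_distrib, ← Finset.mul_sum, hone, hSb, hTb, hTe, hdel]
    ring
  have hN2 : ∀ s, (4:ℤ) * (((D₀ ∩ ((fun x => x + s) '' C₀)).ncard : ℤ) +
      ((D₁ ∩ ((fun x => x + s) '' (Set.univ \ (C₀ ∪ {0})))).ncard : ℤ)) =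
      2 * (2 * m ^ 2 + m + 1) + 2 * (-m * a s + (m + 1) * b s) - 2 * (1 + b s) := by
    intro s
    rw [mul_add, hint, hint, ← Finset.sum_add_distrib]
    simp only [hI0, hI1, hP, hN]
    have : ∀ x, (1 + a x + b x) * (1 + quadraticChar F (x - s) - (if x = s then 1 else 0)) +
        (1 - a x + b x) * (1 - quadraticChar F (x - s) - (if x = s then 1 else 0)) =
        2 * 1 + 2 * b x + 2 * (a x * quadraticChar F (x - s)) -
        (2 * (if x = s then 1 else 0) + 2 * (b x * (if x = s then 1 else 0))) := by
      intro x; ring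
    rw [Finset.sum_congr rfl fun x _ => this x]
    simp only [Finset.sum_add_distrib, Finset.sum_sub_distrib, ← Finset.mul_sum, hone, hSb,
      hTa, hdel, hdel1]
    ring
  have hsq : ∑ x, (a x ^ 2 + b x ^ 2) = 2 * m ^ 2 + 2 * m + 1 := by
    rw [← hone]
    refine Finset.sum_congr rfl fun x _ => ?_
    rcases hab x with ⟨h1, h2⟩ | ⟨h1, h2⟩ | ⟨h1, h2⟩ | ⟨h1, h2⟩ <;> simp [h1, h2]
  rw [Finset.sum_add_distrib] at hsq
  rw [Finset.sum_sub_distrib] at hSab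
  have hmZ : (0:ℤ) < m := by exact_mod_cast hm
  have e1 : ∃ s, a s = 1 ∧ b s = 0 := by
    by_contra! hcon
    have : ∑ x, (a x ^ 2 + a x) = 0 := by
      refine Finset.sum_eq_zero fun x _ => ?_
      have := hcon x
      rcases hab x with ⟨h1, h2⟩ | ⟨h1, h2⟩ | ⟨h1, h2⟩ | ⟨h1, h2⟩ <;>
        first | exact absurd h2 (this h1) | simp [h1, h2]
    rw [Finset.sum_add_distrib, hSa] at this
    nlinarith
  have e2 : ∃ s, a s = 0 ∧ b s = 1 := by
    by_contra! hcon
    have : ∑ x, (b x ^ 2 + b x) = 0 := by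
      refine Finset.sum_eq_zero fun x _ => ?_
      have := hcon x
      rcases hab x with ⟨h1, h2⟩ | ⟨h1, h2⟩ | ⟨h1, h2⟩ | ⟨h1, h2⟩ <;>
        first | exact absurd h2 (this h1) | simp [h1, h2]
    rw [Finset.sum_add_distrib, hSb] at this
    nlinarith
  have e3 : ∃ s, a s = -1 ∧ b s = 0 := by
    by_contra! hcon
    have : ∑ x, (a x ^ 2 - a x) = 0 := by
      refine Finset.sum_eq_zero fun x _ => ?_
      have := hcon x
      rcases hab x with ⟨h1, h2⟩ | ⟨h1, h2⟩ | ⟨h1, h2⟩ | ⟨h1, h2⟩ <;>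
        first | exact absurd h2 (this h1) | simp [h1, h2]
    rw [Finset.sum_sub_distrib, hSa] at this
    nlinarith
  have e4 : ∃ s, a s = 0 ∧ b s = -1 := by
    by_contra! hcon
    have : ∑ x, (b x ^ 2 - b x) = 0 := by
      refine Finset.sum_eq_zero fun x _ => ?_
      have := hcon x
      rcases hab x with ⟨h1, h2⟩ | ⟨h1, h2⟩ | ⟨h1, h2⟩ | ⟨h1, h2⟩ <;>
        first | exact absurd h2 (this h1) | simp [h1, h2]
    rw [Finset.sum_sub_distrib, hSb] at this
    nlinarith
  refine ⟨by exact_mod_cast hc0, by exact_mod_cast hc1, ?_, ?_⟩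
  · ext n
    simp only [Set.mem_range, Set.mem_insert_iff, Set.mem_singleton_iff]
    constructor
    · rintro ⟨s, rfl⟩
      have := hN1 s
      zify
      rcases hab s with ⟨h1, h2⟩ | ⟨h1, h2⟩ | ⟨h1, h2⟩ | ⟨h1, h2⟩ <;> rw [h1, h2] at this
      · right; right; right; linarith
      · right; right; left; linarith
      · left; linarith
      · right; left; linarith
    · zify
      rintro (h | h | h | h)
      · obtain ⟨s, h1, h2⟩ := e3
        have := hN1 s
        rw [h1, h2] at this
        exact ⟨s, by linarith⟩
      · obtain ⟨s, h1, h2⟩ := e4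
        have := hN1 s
        rw [h1, h2] at this
        exact ⟨s, by linarith⟩
      · obtain ⟨s, h1, h2⟩ := e2
        have := hN1 s
        rw [h1, h2] at this
        exact ⟨s, by linarith⟩
      · obtain ⟨s, h1, h2⟩ := e1
        have := hN1 s
        rw [h1, h2] at this
        exact ⟨s, by linarith⟩
  · ext n
    simp only [Set.mem_range, Set.mem_insert_iff, Set.mem_singleton_iff]
    constructor
    · rintro ⟨s, rfl⟩
      have := hN2 s
      zify
      rcases hab s with ⟨h1, h2⟩ | ⟨h1, h2⟩ | ⟨h1, h2⟩ | ⟨h1, h2⟩ <;> rw [h1, h2] at this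
      · left; linarith
      · right; linarith
      · right; linarith
      · left; linarith
    · zify
      rintro (h | h)
      · obtain ⟨s, h1, h2⟩ := e1
        have := hN2 s
        rw [h1, h2] at this
        exact ⟨s, by linarith⟩
      · obtain ⟨s, h1, h2⟩ := e2
        have := hN2 s
        rw [h1, h2] at this
        exact ⟨s, by linarith⟩

lemma proj_sum {F F2 : Type} [Field F] [Fintype F] [Field F2] [Fintype F2] [Algebra F F2]
    (hcard : Fintype.card F2 = Fintype.card F ^ 2) (θ : F2) (hθ : ∀ c : F, algebraMap F F2 c ≠ θ)
    (g : F2 → ℂ) (hg0 : g 0 = 0) (hg : ∀ b : F, b ≠ 0 → ∀ y, g (algebraMap F F2 b * y) = g y) :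
    ∑ y, g y = ((Fintype.card F : ℂ) - 1) * (g θ + ∑ x : F, g (1 + algebraMap F F2 x * θ)) := by
  have hbij : Function.Bijective
      (fun p : F × F => algebraMap F F2 p.1 + algebraMap F F2 p.2 * θ) := by
    rw [Fintype.bijective_iff_injective_and_card]
    refine ⟨?_, by rw [Fintype.card_prod, hcard, sq]⟩
    rintro ⟨u, v⟩ ⟨u', v'⟩ h
    simp only at h
    by_cases hv : v = v'
    · subst hv
      have := (algebraMap F F2).injective (add_right_cancel h)
      rw [this]
    · exfalso
      apply hθ ((u - u') / (v' - v))
      have h1 : algebraMap F F2 v' - algebraMap F F2 v ≠ 0 := by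
        rw [← map_sub]
        exact (map_ne_zero _).mpr (sub_ne_zero.mpr (Ne.symm hv))
      rw [map_div₀, map_sub, map_sub, div_eq_iff h1]
      linear_combination h
  rw [← Function.Bijective.sum_comp hbij g, Fintype.sum_prod_type]
  have hne : ∀ A : ℂ, ∑ v : F, (if v = 0 then 0 else A) = ((Fintype.card F : ℂ) - 1) * A := by
    intro A
    have : ∀ v : F, (if v = 0 then 0 else A) = A - (if v = 0 then A else 0) := by
      intro v; split_ifs <;> simp
    simp only [this, Finset.sum_sub_distrib, Finset.sum_ite_eq', Finset.mem_univ, if_true,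
      Finset.sum_const, Finset.card_univ, nsmul_eq_mul]
    ring
  have key : ∀ u : F, ∑ v : F, g (algebraMap F F2 u + algebraMap F F2 v * θ) =
      (if u = 0 then ((Fintype.card F : ℂ) - 1) * g θ else 0) +
      (if u = 0 then 0 else ∑ x : F, g (1 + algebraMap F F2 x * θ)) := by
    intro u
    by_cases hu : u = 0
    · subst hu
      simp only [map_zero, zero_add, if_true, add_zero]
      rw [← hne]
      refine Finset.sum_congr rfl fun v _ => ?_
      by_cases hv : v = 0
      · simp [hv, hg0]
      · simp [hv, hg v hv]
    · simp only [hu, if_false, zero_add]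
      symm
      refine Fintype.sum_equiv (Equiv.mulLeft₀ u hu) _ _ fun x => ?_
      rw [← hg u hu]
      congr 1
      simp
      ring
  simp only [key, Finset.sum_add_distrib, hne]
  simp
  ring

lemma I_zpow4 (k : ℤ) : I ^ (4 * k) = 1 := by
  rw [zpow_mul]
  have : (I:ℂ) ^ (4:ℤ) = 1 := by
    have := Complex.I_pow_four
    exact_mod_cast this
  rw [this, one_zpow]

lemma I_zpow_cases (n : ℤ) : (n % 4 = 0 ∧ I ^ n = 1) ∨ (n % 4 = 1 ∧ I ^ n = I) ∨
    (n % 4 = 2 ∧ I ^ n = -1) ∨ (n % 4 = 3 ∧ I ^ n = -I) := by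
  have h1 : I ^ n = I ^ (n % 4) := by
    conv_lhs => rw [← Int.mul_ediv_add_emod n 4, zpow_add₀ I_ne_zero, I_zpow4, one_mul]
  rw [h1]
  have : n % 4 = 0 ∨ n % 4 = 1 ∨ n % 4 = 2 ∨ n % 4 = 3 := by omega
  rcases this with h | h | h | h <;> rw [h]
  · simp
  · simp
  · right; right; left
    exact ⟨rfl, by exact_mod_cast I_sq⟩
  · right; right; right
    exact ⟨rfl, by exact_mod_cast I_pow_three⟩

lemma pair_eq (a b c d : ℤ) : (a : ℂ) + b * I = c + d * I ↔ a = c ∧ b = d := by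
  constructor
  · intro h
    have h1 := congrArg Complex.re h
    have h2 := congrArg Complex.im h
    simp at h1 h2
    exact ⟨by exact_mod_cast h1, by exact_mod_cast h2⟩
  · rintro ⟨rfl, rfl⟩; rfl

lemma I_zpow_one (n : ℤ) (h : I ^ n = 1) : n % 4 = 0 := by
  have a1 := pair_eq 0 1 1 0
  have a2 := pair_eq (-1) 0 1 0
  have a3 := pair_eq 0 (-1) 1 0
  simp at a1 a2 a3
  rcases I_zpow_cases n with ⟨h1, h2⟩ | ⟨h1, h2⟩ | ⟨h1, h2⟩ | ⟨h1, h2⟩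
  · exact h1
  · exact absurd (h2.symm.trans h) a1
  · rw [h] at h2; exfalso; revert h2; norm_num
  · exact absurd (h2.symm.trans h) a3

lemma chi_zpow {F2 : Type} [Field F2] (ω : F2ˣ) (χ : MulChar F2 ℂ)
    (hχω : χ (ω : F2) = I) (k : ℤ) : χ ((ω ^ k : F2ˣ) : F2) = I ^ k := by
  have := map_zpow (χ.toMonoidHom.comp (Units.coeHom F2)) ω k
  simpa [hχω] using this

lemma exists_zpow {F2 : Type} [Field F2] (ω : F2ˣ)
    (hω : ∀ x : F2ˣ, x ∈ Subgroup.zpowers ω) (y : F2) (hy : y ≠ 0) :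
    ∃ k : ℤ, y = ((ω ^ k : F2ˣ) : F2) := by
  obtain ⟨k, hk⟩ := hω (Units.mk0 y hy)
  exact ⟨k, by simpa using (congrArg Units.val hk).symm⟩

lemma mem_cyc {F2 : Type} [Field F2] (ω : F2ˣ)
    (hω : ∀ x : F2ˣ, x ∈ Subgroup.zpowers ω) (χ : MulChar F2 ℂ)
    (hχω : χ (ω : F2) = I) (y : F2) (j : ℤ) : y ∈ cyc ω 4 j ↔ χ y = I ^ j := by
  constructor
  · rintro ⟨k, rfl⟩
    rw [chi_zpow ω χ hχω, zpow_add₀ I_ne_zero]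
    have := I_zpow4 k
    simp only [Nat.cast_ofNat]
    rw [this, mul_one]
  · intro h
    have hy : y ≠ 0 := by
      rintro rfl
      rw [MulChar.map_zero] at h
      exact zpow_ne_zero j I_ne_zero h.symm
    obtain ⟨k, rfl⟩ := exists_zpow ω hω y hy
    rw [chi_zpow ω χ hχω] at h
    have h1 : I ^ (k - j) = 1 := by
      rw [zpow_sub₀ I_ne_zero, h, div_self (zpow_ne_zero j I_ne_zero)]
    have h2 := I_zpow_one _ h1
    refine ⟨(k - j) / 4, ?_⟩
    congr 2
    push_cast
    omega

lemma chi_restrict {F F2 : Type} [Field F] [Fintype F] [Field F2] [Fintype F2] [Algebra F F2]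
    (q : ℕ) (hq4 : q % 4 = 1)
    (hF : Fintype.card F = q) (hF2 : Fintype.card F2 = q ^ 2) (hchar : ringChar F ≠ 2)
    (ω : F2ˣ) (hω : ∀ x : F2ˣ, x ∈ Subgroup.zpowers ω)
    (tr : F2 → F) (htr : ∀ x : F2, algebraMap F F2 (tr x) = x + x ^ q)
    (χ : MulChar F2 ℂ) (hχω : χ (ω : F2) = Complex.I) (a : F) :
    χ (algebraMap F F2 a) = (quadraticChar F a : ℂ) := by
  have h2 : (2:F) ≠ 0 := Ring.two_ne_zero hchar
  have h22 : (2:F2) ≠ 0 := by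
    have := (map_ne_zero (algebraMap F F2)).mpr h2
    rwa [map_ofNat] at this
  have hq1 : 1 < q := hF ▸ Fintype.one_lt_card
  have hord : orderOf ω = q ^ 2 - 1 := by
    rw [orderOf_eq_card_of_forall_mem_zpowers hω, Nat.card_eq_fintype_card, Fintype.card_units, hF2]
  have hIq : I ^ (q + 1) = (-1 : ℂ) := by
    have : q + 1 = 4 * (q / 4) + 2 := by omega
    rw [this, pow_add, pow_mul, I_pow_four, one_pow, one_mul, I_sq]
  have hsq : ∀ b : F, b ≠ 0 → χ (algebraMap F F2 b) ^ 2 = 1 := by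
    intro b hb
    have hb' : algebraMap F F2 b ≠ 0 := (map_ne_zero _).mpr hb
    obtain ⟨k, hk⟩ := exists_zpow ω hω _ hb'
    have h1 : b ^ (q - 1) = 1 := by rw [← hF]; exact FiniteField.pow_card_sub_one_eq_one b hb
    have h3 : ω ^ (k * ((q - 1 : ℕ) : ℤ)) = 1 := by
      rw [zpow_mul, zpow_natCast]
      ext
      rw [Units.val_pow_eq_pow_val, ← hk, ← map_pow, h1, map_one, Units.val_one]
    rw [← orderOf_dvd_iff_zpow_eq_one, hord] at h3
    have h4 : ((q ^ 2 - 1 : ℕ) : ℤ) = ((q:ℤ) + 1) * ((q - 1 : ℕ) : ℤ) := by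
      rw [Nat.cast_sub (Nat.one_le_pow _ _ (by omega)), Nat.cast_sub (by omega)]
      push_cast; ring
    rw [h4] at h3
    have h5 : ((q:ℤ) + 1) ∣ k := by
      refine Int.dvd_of_mul_dvd_mul_right (a := ((q - 1 : ℕ) : ℤ)) ?_ h3
      have : q - 1 ≠ 0 := by omega
      exact_mod_cast this
    obtain ⟨t, rfl⟩ := h5
    rw [hk, chi_zpow ω χ hχω, zpow_mul]
    have : I ^ ((q:ℤ) + 1) = -1 := by
      rw [← hIq]
      exact_mod_cast zpow_natCast I (q + 1)
    rw [this, ← zpow_natCast, ← zpow_mul, mul_comm, zpow_mul]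
    norm_num
  obtain ⟨c, hc⟩ : ∃ c : F, algebraMap F F2 c = (ω : F2) ^ (q + 1) := by
    refine ⟨tr ((ω : F2) ^ (q + 1)) / 2, ?_⟩
    rw [map_div₀, htr]
    have hωq : (ω : F2) ^ (q ^ 2) = ω := by rw [← hF2]; exact FiniteField.pow_card _
    have : ((ω : F2) ^ (q + 1)) ^ q = (ω : F2) ^ (q + 1) := by
      rw [← pow_mul, add_mul, one_mul, ← sq, pow_add, hωq, pow_succ, mul_comm]
    rw [this, map_ofNat]
    field_simp
    ring
  have hχc : χ (algebraMap F F2 c) = -1 := by rw [hc, map_pow, hχω, hIq]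
  have hc0 : c ≠ 0 := by
    rintro rfl
    rw [map_zero, MulChar.map_zero] at hχc
    norm_num at hχc
  have hsquare : ∀ b : F, b ≠ 0 → IsSquare b → χ (algebraMap F F2 b) = 1 := by
    rintro b hb ⟨r, rfl⟩
    have hr : r ≠ 0 := by rintro rfl; simp at hb
    rw [map_mul, map_mul, ← sq, hsq r hr]
  have hcn : ¬ IsSquare c := by
    intro h
    rw [hsquare c hc0 h] at hχc
    norm_num at hχc
  by_cases ha : a = 0
  · subst ha
    simp [MulChar.map_zero]
  by_cases has : IsSquare a
  · rw [hsquare a ha has, (quadraticChar_one_iff_isSquare ha).mpr has]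
    simp
  · have h1 := quadraticChar_neg_one_iff_not_isSquare.mpr has
    have h3 := quadraticChar_neg_one_iff_not_isSquare.mpr hcn
    have h4 : IsSquare (a * c) := by
      rw [← quadraticChar_one_iff_isSquare (mul_ne_zero ha hc0), map_mul, h1, h3]
      norm_num
    have h5 := hsquare _ (mul_ne_zero ha hc0) h4
    rw [map_mul, map_mul, hχc] at h5
    rw [h1]
    push_cast
    linear_combination -h5

lemma quadChar_eq {F : Type} [Field F] [Fintype F] (x : F) :
    quadChar F x = (quadraticChar F x : ℂ) := by
  unfold quadChar
  by_cases hx : x = 0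
  · simp [hx]
  · by_cases hs : IsSquare x
    · rw [(quadraticChar_one_iff_isSquare hx).mpr hs]; simp [hx, hs]
    · rw [quadraticChar_neg_one_iff_not_isSquare.mpr hs]; simp [hx, hs]

lemma key_sum {F F2 : Type} [Field F] [Fintype F] [Field F2] [Fintype F2] [Algebra F F2]
    (q : ℕ) (hq4 : q % 4 = 1)
    (hF : Fintype.card F = q) (hF2 : Fintype.card F2 = q ^ 2) (hchar : ringChar F ≠ 2)
    (ψ : AddChar F ℂ) (hψ : ∃ a, ψ a ≠ 1)
    (tr : F2 → F) (htr : ∀ x : F2, algebraMap F F2 (tr x) = x + x ^ q)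
    (χ : MulChar F2 ℂ) (hχη : ∀ a : F, χ (algebraMap F F2 a) = (quadraticChar F a : ℂ))
    (K : ℂ)
    (hGauss : (∑ x : F, quadChar F x * ψ x) * (∑ y : F2, χ y * ψ (tr y)) / q = K)
    (θ : F2) (hθ : ∀ c : F, algebraMap F F2 c ≠ θ) (a : F2) (ha : a ≠ 0) :
    χ a * (χ θ * (quadraticChar F (tr (a * θ)) : ℂ) +
      ∑ x : F, χ (1 + algebraMap F F2 x * θ) *
        (quadraticChar F (tr (a * (1 + algebraMap F F2 x * θ))) : ℂ)) = K := by
  have hq1 : 1 < q := hF ▸ Fintype.one_lt_card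
  have hqC : (q : ℂ) ≠ 0 := by exact_mod_cast (by omega : q ≠ 0)
  have hqC1 : (q : ℂ) - 1 ≠ 0 := by
    rw [sub_ne_zero]; exact_mod_cast (by omega : q ≠ 1)
  have htrm : ∀ (b : F) (y : F2), tr (algebraMap F F2 b * y) = b * tr y := by
    intro b y
    apply (algebraMap F F2).injective
    rw [htr, map_mul, htr, mul_pow, ← map_pow, ← hF, FiniteField.pow_card]
    ring
  have htr0 : tr 0 = 0 := by
    have := htrm 0 0
    simpa using this
  set η : MulChar F ℂ := (quadraticChar F).ringHomComp (Int.castRingHom ℂ) with hη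
  have hηa : ∀ x, η x = (quadraticChar F x : ℂ) := fun x => by simp [hη]
  have hηsq : ∀ b : F, b ≠ 0 → (quadraticChar F b : ℂ) * (quadraticChar F b : ℂ) = 1 := by
    intro b hb
    have := quadraticChar_sq_one hb
    rw [← sq]
    exact_mod_cast this
  have hη1 : η ≠ 1 := by
    intro h
    apply quadraticChar_ne_one hchar
    ext x
    have := DFunLike.congr_fun h (x : F)
    rw [hηa] at this
    rw [MulChar.one_apply_coe] at this ⊢
    exact_mod_cast this
  have hψ1 : ψ ≠ 1 := by
    rintro rfl
    obtain ⟨a, ha⟩ := hψ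
    exact ha rfl
  have hprim : ψ.IsPrimitive := AddChar.IsPrimitive.of_ne_one hψ1
  have hG2 : gaussSum η ψ ^ 2 = q := by
    rw [gaussSum_sq hη1 ((quadraticChar_isQuadratic F).comp _) hprim, hF, hηa,
      (quadraticChar_one_iff_isSquare (neg_ne_zero.mpr one_ne_zero)).mpr
        (FiniteField.isSquare_neg_one_iff.mpr (by omega))]
    simp
  set P : ℂ := ∑ y : F2, χ y * (quadraticChar F (tr y) : ℂ) with hP
  set Gχ : ℂ := ∑ y : F2, χ y * ψ (tr y) with hGχ
  have hGη : ∑ x : F, quadChar F x * ψ x = gaussSum η ψ := by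
    unfold gaussSum
    simp only [quadChar_eq, hηa]
  have hshift : ∀ c : F, ∑ b : F, (quadraticChar F b : ℂ) * ψ (b * c) =
      (quadraticChar F c : ℂ) * gaussSum η ψ := by
    intro c
    by_cases hc : c = 0
    · subst hc
      simp only [mul_zero, AddChar.map_zero_eq_one, mul_one, quadraticChar_zero, Int.cast_zero,
        zero_mul]
      exact_mod_cast quadraticChar_sum_zero hchar
    · have := gaussSum_mulShift η ψ (Units.mk0 c hc)
      rw [← this, hηa, Units.val_mk0, ← mul_assoc, hηsq c hc, one_mul]
      unfold gaussSum
      refine Finset.sum_congr rfl fun b _ => ?_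
      rw [hηa, AddChar.mulShift_apply, mul_comm b c]
  have hmain : ((q : ℂ) - 1) * Gχ = gaussSum η ψ * P := by
    have e1 : ∑ y : F2, ∑ b : F, χ y * ((quadraticChar F b : ℂ) * ψ (b * tr y)) =
        gaussSum η ψ * P := by
      rw [hP, Finset.mul_sum]
      refine Finset.sum_congr rfl fun y _ => ?_
      rw [← Finset.mul_sum, hshift]
      ring
    have e2 : ∀ b : F, ∑ y : F2, χ y * ((quadraticChar F b : ℂ) * ψ (b * tr y)) =
        Gχ - (if b = 0 then Gχ else 0) := by
      intro b
      by_cases hb : b = 0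
      · simp [hb]
      · rw [if_neg hb, sub_zero, hGχ]
        have hb' : algebraMap F F2 b ≠ 0 := (map_ne_zero _).mpr hb
        refine Fintype.sum_equiv (Equiv.mulLeft₀ _ hb') _ _ fun y => ?_
        change _ = χ (algebraMap F F2 b * y) * ψ (tr (algebraMap F F2 b * y))
        rw [htrm, map_mul χ, hχη]
        ring
    rw [← e1, Finset.sum_comm]
    simp only [e2, Finset.sum_sub_distrib, Finset.sum_const, Finset.card_univ, nsmul_eq_mul, hF,
      Finset.sum_ite_eq', Finset.mem_univ, if_true]
    ring
  have hPK : P = ((q : ℂ) - 1) * K := by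
    rw [← hGauss, hGη]
    field_simp
    linear_combination (-gaussSum η ψ) * hmain - P * hG2
  have hproj := proj_sum (by rw [hF, hF2]) θ hθ
    (fun y => χ y * (quadraticChar F (tr (a * y)) : ℂ))
    (by simp [MulChar.map_zero])
    (by
      intro b hb y
      have : a * (algebraMap F F2 b * y) = algebraMap F F2 b * (a * y) := by ring
      rw [this, htrm, map_mul, map_mul, hχη, Int.cast_mul]
      linear_combination (χ y * (quadraticChar F (tr (a * y)) : ℂ)) * hηsq b hb)
  have hre : χ a * ∑ y : F2, χ y * (quadraticChar F (tr (a * y)) : ℂ) = P := by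
    rw [hP, Finset.mul_sum]
    refine Fintype.sum_equiv (Equiv.mulLeft₀ _ ha) _ _ fun y => ?_
    change _ = χ (a * y) * (quadraticChar F (tr (a * y)) : ℂ)
    rw [map_mul]
    ring
  rw [hproj, hF, hPK] at hre
  apply mul_left_cancel₀ hqC1
  linear_combination hre

/-- the four-intersection sets of Theorem 5.6 of the paper (`m` even). -/
theorem stmt_16 (m q : ℕ) (hm : 0 < m) (hmeven : Even m)
    (hq : q = 2 * m ^ 2 + 2 * m + 1) (hqpp : IsPrimePow q)
    (F F2 : Type) [Field F] [Fintype F] [Field F2] [Fintype F2] [Algebra F F2]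
    (hF : Fintype.card F = q) (hF2 : Fintype.card F2 = q ^ 2)
    (ω : F2ˣ) (hω : ∀ x : F2ˣ, x ∈ Subgroup.zpowers ω)
    (ψ : AddChar F ℂ) (hψ : ∃ a, ψ a ≠ 1)
    (tr : F2 → F) (htr : ∀ x : F2, algebraMap F F2 (tr x) = x + x ^ q)
    (χ : MulChar F2 ℂ) (hχω : χ (ω : F2) = Complex.I)
    (ε δ : ℤ) (hε : ε = 1 ∨ ε = -1) (hδ : δ = 1 ∨ δ = -1)
    (hGauss : (∑ x : F, quadChar F x * ψ x) * (∑ y : F2, χ y * ψ (tr y)) / q =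
      (ε : ℂ) * (m + 1) + (δ : ℂ) * m * Complex.I)
    (h : ℤ) (hh : h = 0 ∨ h = 1 ∨ h = 2 ∨ h = 3)
    (ℓ : ℤ)
    (hχℓ : χ ((ω ^ ℓ : F2ˣ) : F2) = Complex.I ^ (3 + h))
    (hχd : χ (((ω ^ (ℓ * (q : ℤ)) : F2ˣ) : F2) - ((ω ^ ℓ : F2ˣ) : F2)) =
      Complex.I ^ (δ * (1 + 2 * h)))
    (H₀ H₁ : Finset ℤ)
    (hH1 : ε * δ = 1 → H₀ = ({h, h + 1} : Finset ℤ) ∧ H₁ = ({h + 1, h + 2} : Finset ℤ))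
    (hH2 : ε * δ = -1 → H₀ = ({h + 1, h + 2} : Finset ℤ) ∧ H₁ = ({h, h + 1} : Finset ℤ))
    (C₀ : Set F) (hC₀ : C₀ = {x : F | x ≠ 0 ∧ IsSquare x})
    (D₀ D₁ : Set F)
    (hD₀ : D₀ = {x : F | ∃ j ∈ H₀,
      (1 + algebraMap F F2 x * ((ω ^ ℓ : F2ˣ) : F2)) ∈ cyc ω 4 j})
    (hD₁ : D₁ = {x : F | ∃ j ∈ H₁,
      (1 + algebraMap F F2 x * ((ω ^ ℓ : F2ˣ) : F2)) ∈ cyc ω 4 j}) :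
    D₀.ncard = m ^ 2 ∧ D₁.ncard = m ^ 2 + m + 1 ∧
      (Set.range fun s : F =>
          (D₀ ∩ ((fun x => x + s) '' (C₀ ∪ {0}))).ncard +
            (D₁ ∩ ((fun x => x + s) '' C₀)).ncard) =
        ({m ^ 2, m ^ 2 + 1, m ^ 2 + m + 1, m ^ 2 + m + 2} : Set ℕ) ∧
      (Set.range fun s : F =>
          (D₀ ∩ ((fun x => x + s) '' C₀)).ncard +
            (D₁ ∩ ((fun x => x + s) '' (Set.univ \ (C₀ ∪ {0})))).ncard) =
        ({m ^ 2, m ^ 2 + m} : Set ℕ) := by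
  subst hF
  set q := Fintype.card F with hqdef
  obtain ⟨m', hm'⟩ := hmeven
  have hq4 : q % 4 = 1 := by
    rw [hq, hm']
    have : 2 * (m' + m') ^ 2 + 2 * (m' + m') + 1 = 4 * (2 * m' ^ 2 + m') + 1 := by ring
    rw [this]; omega
  have hchar : ringChar F ≠ 2 := by
    intro h
    have := FiniteField.even_card_of_char_two h
    omega
  have hχη := chi_restrict q hq4 rfl hF2 hchar ω hω tr htr χ hχω
  set θ : F2 := ((ω ^ ℓ : F2ˣ) : F2) with hθdef
  have hθ0 : θ ≠ 0 := Units.ne_zero _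
  set K : ℂ := (ε : ℂ) * (m + 1) + (δ : ℂ) * m * Complex.I with hK
  set f := FiniteField.frobeniusAlgHom F F2 with hf
  have hfa : ∀ y, f y = y ^ q := fun y => rfl
  set t : F2 := f θ with ht
  have hft : f t = θ := by
    rw [ht, hfa, hfa, ← pow_mul, ← sq, ← hF2]
    exact FiniteField.pow_card _
  have hfφ : ∀ x, f (algebraMap F F2 x) = algebraMap F F2 x := fun x => f.commutes x
  have htω : ((ω ^ (ℓ * (q : ℤ)) : F2ˣ) : F2) = t := by
    rw [zpow_mul, zpow_natCast, Units.val_pow_eq_pow_val, ← hθdef, ← hfa]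
  rw [htω] at hχd
  have hD : t - θ ≠ 0 := by
    intro h
    rw [h, MulChar.map_zero] at hχd
    exact zpow_ne_zero _ I_ne_zero hχd.symm
  have hθn : ∀ c : F, algebraMap F F2 c ≠ θ := by
    rintro c hc
    apply hD
    rw [ht, ← hc, hfφ, sub_self]
  have htreq : ∀ (y : F2) (c : F), y + f y = algebraMap F F2 c → tr y = c := by
    intro y c h
    apply (algebraMap F F2).injective
    rw [htr, ← h, hfa]
  have hne : ∀ s : F, 1 + algebraMap F F2 s * θ ≠ 0 := by
    intro s hs
    have hs0 : s ≠ 0 := by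
      rintro rfl
      simp at hs
    have h1 : algebraMap F F2 s ≠ 0 := (map_ne_zero _).mpr hs0
    apply hθn (-1 / s)
    rw [map_div₀, map_neg, map_one, div_eq_iff h1]
    linear_combination -hs
  have hχf : ∀ y, y ≠ 0 → χ (f y) = χ y := by
    intro y hy
    obtain ⟨k, rfl⟩ := exists_zpow ω hω y hy
    rw [hfa, map_pow, chi_zpow ω χ hχω]
    have : q = 4 * (q / 4) + 1 := by omega
    rw [this, pow_succ, pow_mul, ← zpow_natCast (I ^ k) 4, ← zpow_mul, mul_comm k]
    have h4 := I_zpow4 k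
    push_cast
    rw [h4, one_pow, one_mul]
  have hχneg : χ (-1) = 1 := by
    have := hχη (-1)
    rw [map_neg, map_one, (quadraticChar_one_iff_isSquare (neg_ne_zero.mpr one_ne_zero)).mpr
        (FiniteField.isSquare_neg_one_iff.mpr (by omega))] at this
    simpa using this
  have hks := fun a ha => key_sum q hq4 rfl hF2 hchar ψ hψ tr htr χ hχη K hGauss θ hθn a ha
  have hχD0 : χ (t - θ) ≠ 0 := by
    rw [hχd]; exact zpow_ne_zero _ I_ne_zero
  have hdiv : ∀ y z : F2, z ≠ 0 → χ (y / z) * χ z = χ y := by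
    intro y z hz
    rw [← map_mul, div_mul_cancel₀ _ hz]
  have hD' : θ - t ≠ 0 := by
    intro h
    apply hD
    linear_combination -h
  -- first relation
  have E1 : χ θ * ∑ x : F, χ (1 + algebraMap F F2 x * θ) = χ (t - θ) * K := by
    have ht0 : t ≠ 0 := by rw [ht]; exact (map_ne_zero f).mpr hθ0
    have h1 := hks (t / (t - θ)) (div_ne_zero ht0 hD)
    have h2 : tr (t / (t - θ) * θ) = 0 := by
      apply htreq
      rw [map_mul, map_div₀, map_sub, hft, ← ht, map_zero]
      field_simp
      ring
    have h3 : ∀ x, tr (t / (t - θ) * (1 + algebraMap F F2 x * θ)) = 1 := by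
      intro x
      apply htreq
      rw [map_mul, map_div₀, map_sub, map_add, map_mul, hfφ, hft, ← ht, map_one, map_one]
      field_simp
      ring
    simp only [h2, h3, quadraticChar_zero, map_one, Int.cast_zero, Int.cast_one, mul_zero, zero_add,
      mul_one] at h1
    have h4 := hdiv t (t - θ) hD
    rw [hχf θ hθ0] at h4
    rw [← h4, ← h1]
    ring
  have E2 : ∀ s, χ (1 + algebraMap F F2 s * θ) * (χ θ +
      ∑ x : F, χ (1 + algebraMap F F2 x * θ) * (quadraticChar F (x - s) : ℂ)) =
      χ (t - θ) * K := by
    intro s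
    have hfs : f (1 + algebraMap F F2 s * θ) = 1 + algebraMap F F2 s * t := by
      rw [map_add, map_mul, hfφ, ← ht, map_one]
    have hs0 : 1 + algebraMap F F2 s * t ≠ 0 := by
      rw [← hfs]; exact (map_ne_zero f).mpr (hne s)
    have h1 := hks (-1 * (1 + algebraMap F F2 s * t) / (t - θ))
      (div_ne_zero (mul_ne_zero (neg_ne_zero.mpr one_ne_zero) hs0) hD)
    have h2 : tr (-1 * (1 + algebraMap F F2 s * t) / (t - θ) * θ) = 1 := by
      apply htreq
      rw [map_mul, map_div₀, map_mul, map_neg, map_sub, map_add, map_mul, hfφ, hft, ← ht, map_one,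
        map_one]
      field_simp
      ring
    have h3 : ∀ x, tr (-1 * (1 + algebraMap F F2 s * t) / (t - θ) *
        (1 + algebraMap F F2 x * θ)) = x - s := by
      intro x
      apply htreq
      simp only [map_mul, map_div₀, map_neg, map_sub, map_add, hfφ, hft, ← ht, map_one]
      field_simp
      ring
    simp only [h2, h3, map_one, Int.cast_one, mul_one] at h1
    have h4 := hdiv (-1 * (1 + algebraMap F F2 s * t)) (t - θ) hD
    rw [map_mul, hχneg, one_mul, ← hfs, hχf _ (hne s), hfs] at h4
    rw [← h4, ← h1]
    ring
  have E3 : χ θ ^ 2 + ∑ x : F, χ (1 + algebraMap F F2 x * θ) ^ 2 = 0 := by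
    have hq1 : 1 < q := Fintype.one_lt_card
    have hqC1 : (q : ℂ) - 1 ≠ 0 := by
      rw [sub_ne_zero]; exact_mod_cast (by omega : q ≠ 1)
    have h1 := proj_sum hF2 θ hθn (fun y => χ y ^ 2) (by simp [MulChar.map_zero]) (by
      intro b hb y
      have := quadraticChar_sq_one hb
      rw [map_mul, mul_pow, hχη]
      have h2 : (quadraticChar F b : ℂ) ^ 2 = 1 := by exact_mod_cast this
      rw [h2, one_mul])
    have h2 : ∑ y : F2, χ y ^ 2 = 0 := by
      have hn : χ ^ 2 ≠ 1 := by
        intro h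
        have := DFunLike.congr_fun h (ω : F2)
        rw [MulChar.one_apply_coe, MulChar.pow_apply_coe, hχω, I_sq] at this
        norm_num at this
      rw [← MulChar.sum_eq_zero_of_ne_one hn]
      refine Finset.sum_congr rfl fun y _ => ?_
      rw [MulChar.pow_apply' _ two_ne_zero]
    rw [h2] at h1
    rcases mul_eq_zero.mp h1.symm with h | h
    · exact absurd h hqC1
    · exact h
  set J : ℂ := I ^ h with hJ
  have hJ0 : J ≠ 0 := zpow_ne_zero _ I_ne_zero
  have hJ4 : J ^ 4 = 1 := by
    rw [hJ, ← zpow_natCast, ← zpow_mul, mul_comm]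
    exact I_zpow4 h
  have hI3 : (I : ℂ) ^ (3:ℤ) = -I := by exact_mod_cast I_pow_three
  have hI2 : (I : ℂ) ^ (2:ℤ) = -1 := by exact_mod_cast I_sq
  have hχθ' : χ θ = -I * J := by
    rw [hχℓ, zpow_add₀ I_ne_zero, hI3]
  have hJ2 : I ^ (2 * h) = J ^ 2 := by
    rw [mul_comm, zpow_mul]; exact_mod_cast rfl
  have hχD' : χ (t - θ) = δ * I * J ^ 2 := by
    rw [hχd]
    rcases hδ with rfl | rfl
    · rw [one_mul, zpow_add₀ I_ne_zero, hJ2]; simp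
    · rw [neg_one_mul, zpow_neg, zpow_add₀ I_ne_zero, hJ2]
      simp only [zpow_one]
      rw [inv_eq_iff_eq_inv, ← mul_left_inj' (mul_ne_zero I_ne_zero (pow_ne_zero 2 hJ0))]
      rw [eq_comm, inv_mul_eq_iff_eq_mul₀]
      · push_cast
        linear_combination (I ^ 3 * J ^ 2) * hJ4 + (I * J ^ 2) * I_sq
      · push_cast
        simp [I_ne_zero, hJ0]
  clear_value J
  obtain ⟨σ, hσ⟩ : ∃ σ, σ = ε * δ := ⟨_, rfl⟩
  have hσ1 : σ = 1 ∨ σ = -1 := by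
    rcases hε with rfl | rfl <;> rcases hδ with rfl | rfl <;> simp [hσ]
  have hδ2 : (δ : ℂ) * δ = 1 := by
    rcases hδ with rfl | rfl <;> simp
  have hσ2 : σ * σ = 1 := by
    rcases hσ1 with rfl | rfl <;> simp
  have hσ2C : (σ : ℂ) * σ = 1 := by exact_mod_cast hσ2
  have hδK : (δ : ℂ) * K = σ * (m + 1) + m * I := by
    rw [hK, hσ]; push_cast
    linear_combination (m * I) * hδ2
  have hex : ∀ x : F, ∃ a b : ℤ, ((a = 1 ∧ b = 0) ∨ (a = 0 ∧ b = 1) ∨ (a = -1 ∧ b = 0) ∨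
      (a = 0 ∧ b = -1)) ∧ χ (1 + algebraMap F F2 x * θ) = J * (((σ * a : ℤ) : ℂ) + (b : ℂ) * I) := by
    intro x
    obtain ⟨k, hk⟩ := exists_zpow ω hω _ (hne x)
    rw [hk, chi_zpow ω χ hχω]
    have h1 : I ^ k = J * I ^ (k - h) := by
      rw [hJ, ← zpow_add₀ I_ne_zero]; congr 1; ring
    rw [h1]
    rcases I_zpow_cases (k - h) with ⟨_, h2⟩ | ⟨_, h2⟩ | ⟨_, h2⟩ | ⟨_, h2⟩ <;> rw [h2]
    · refine ⟨σ, 0, by rcases hσ1 with rfl | rfl <;> simp, ?_⟩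
      rw [hσ2]; simp
    · exact ⟨0, 1, by simp, by simp⟩
    · refine ⟨-σ, 0, by rcases hσ1 with rfl | rfl <;> simp, ?_⟩
      rw [mul_neg σ, hσ2]; simp
    · exact ⟨0, -1, by simp, by simp⟩
  choose a b hab hw using hex
  have hnorm : ∀ x, a x * a x + b x * b x = 1 := by
    intro x
    rcases hab x with ⟨h1, h2⟩ | ⟨h1, h2⟩ | ⟨h1, h2⟩ | ⟨h1, h2⟩ <;> rw [h1, h2] <;> norm_num
  have hab0 : ∀ x, a x * b x = 0 := by
    intro x
    rcases hab x with ⟨h1, h2⟩ | ⟨h1, h2⟩ | ⟨h1, h2⟩ | ⟨h1, h2⟩ <;> rw [h1, h2] <;> norm_num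
  have hS : σ * ∑ x, a x = -(σ * (m + 1)) ∧ ∑ x, b x = -m := by
    rw [← pair_eq]
    simp only [hw, ← Finset.mul_sum, Finset.sum_add_distrib, ← Finset.sum_mul] at E1
    rw [hχθ', hχD'] at E1
    push_cast at E1 ⊢
    rw [← Finset.mul_sum] at E1
    have hc : (I * J ^ 2 : ℂ) ≠ 0 := mul_ne_zero I_ne_zero (pow_ne_zero 2 hJ0)
    apply mul_left_cancel₀ hc
    linear_combination -E1 - I * J ^ 2 * hδK
  have hT : ∀ s, σ * ∑ x, a x * quadraticChar F (x - s) =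
        σ * (-m * a s + (m + 1) * b s) ∧
      ∑ x, b x * quadraticChar F (x - s) = (m + 1) * a s + m * b s + 1 := by
    intro s
    rw [← pair_eq]
    have h1 := E2 s
    have h2 : ∀ x, J * (((σ * a x : ℤ) : ℂ) + (b x : ℂ) * I) * (quadraticChar F (x - s) : ℂ) =
      J * σ * ((a x : ℂ) * (quadraticChar F (x - s) : ℂ)) +
      J * I * ((b x : ℂ) * (quadraticChar F (x - s) : ℂ)) := by
      intro x; push_cast; ring
    simp only [hw, h2, Finset.sum_add_distrib, ← Finset.mul_sum] at h1
    rw [hχθ', hχD'] at h1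
    push_cast at h1 ⊢
    have hn : (a s : ℂ) * a s + b s * b s = 1 := by exact_mod_cast hnorm s
    set A : ℂ := ∑ x, (a x : ℂ) * (quadraticChar F (x - s) : ℂ)
    set B : ℂ := ∑ x, (b x : ℂ) * (quadraticChar F (x - s) : ℂ)
    have hJJ : J ^ 2 ≠ 0 := pow_ne_zero 2 hJ0
    have h3 : ((σ : ℂ) * a s + b s * I) * (-I + (σ * A + B * I)) =
        I * (σ * (m + 1) + m * I) := by
      apply mul_left_cancel₀ hJJ
      linear_combination h1 + I * J ^ 2 * hδK
    have h4 : ((σ : ℂ) * a s + b s * I) * ((σ : ℂ) * a s - b s * I) = 1 := by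
      linear_combination hn + (a s : ℂ) ^ 2 * hσ2C - (b s : ℂ) ^ 2 * I_sq
    have h5 : (-I + (σ * A + B * I)) =
        ((σ : ℂ) * a s - b s * I) * (I * (σ * (m + 1) + m * I)) := by
      rw [← h3]
      linear_combination -(-I + (σ * A + B * I)) * h4
    linear_combination h5 + (I * (m + 1) * a s) * hσ2C +
      (σ * a s * m - b s * σ * (m + 1) - b s * m * I) * I_sq
  have hSab : ∑ x, (a x ^ 2 - b x ^ 2) = 1 := by
    have h2 : ∀ x, (J * (((σ * a x : ℤ) : ℂ) + (b x : ℂ) * I)) ^ 2 =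
        J ^ 2 * (((a x ^ 2 - b x ^ 2 : ℤ)) : ℂ) := by
      intro x
      have h0 : (a x : ℂ) * b x = 0 := by exact_mod_cast hab0 x
      push_cast
      linear_combination J ^ 2 * a x ^ 2 * hσ2C + J ^ 2 * b x ^ 2 * I_sq +
        2 * J ^ 2 * σ * I * h0
    simp only [hw, h2, ← Finset.mul_sum] at E3
    rw [hχθ', ← Int.cast_sum] at E3
    have hJJ : J ^ 2 ≠ 0 := pow_ne_zero 2 hJ0
    have h3 : ((∑ x, (a x ^ 2 - b x ^ 2) : ℤ) : ℂ) = 1 := by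
      apply mul_left_cancel₀ hJJ
      linear_combination E3 - J ^ 2 * I_sq
    exact_mod_cast h3
  have hσ0 : σ ≠ 0 := by rcases hσ1 with rfl | rfl <;> simp
  have hwc : ∀ x (c d : ℤ), J * (((σ * a x : ℤ) : ℂ) + (b x : ℂ) * I) = J * (c + d * I) ↔
      σ * a x = c ∧ b x = d := by
    intro x c d
    rw [mul_right_inj' hJ0, pair_eq]
  have hcyc : ∀ x (n c d : ℤ), I ^ n = (c + d * I : ℂ) →
      (1 + algebraMap F F2 x * θ ∈ cyc ω 4 (h + n) ↔ σ * a x = c ∧ b x = d) := by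
    intro x n c d hn
    rw [mem_cyc ω hω χ hχω, hw, zpow_add₀ I_ne_zero, ← hJ, hn, hwc]
  have c0 : ∀ x, 1 + algebraMap F F2 x * θ ∈ cyc ω 4 h ↔ σ * a x = 1 ∧ b x = 0 := by
    intro x
    have := hcyc x 0 1 0 (by simp)
    rwa [add_zero] at this
  have c1 : ∀ x, 1 + algebraMap F F2 x * θ ∈ cyc ω 4 (h + 1) ↔ σ * a x = 0 ∧ b x = 1 :=
    fun x => hcyc x 1 0 1 (by simp)
  have c2 : ∀ x, 1 + algebraMap F F2 x * θ ∈ cyc ω 4 (h + 2) ↔ σ * a x = -1 ∧ b x = 0 :=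
    fun x => hcyc x 2 (-1) 0 (by rw [hI2]; simp)
  have hA : ∀ x, x ∈ D₀ ↔ a x = 1 ∨ b x = 1 := by
    intro x
    rcases hσ1 with h1 | h1
    · rw [hD₀, (hH1 (hσ ▸ h1)).1]
      simp only [Finset.mem_insert, Finset.mem_singleton, Set.mem_setOf_eq, exists_eq_or_imp,
        exists_eq_left, c0, c1, h1]
      have := hab x
      omega
    · rw [hD₀, (hH2 (hσ ▸ h1)).1]
      simp only [Finset.mem_insert, Finset.mem_singleton, Set.mem_setOf_eq, exists_eq_or_imp,
        exists_eq_left, c2, c1, h1]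
      have := hab x
      omega
  have hB : ∀ x, x ∈ D₁ ↔ a x = -1 ∨ b x = 1 := by
    intro x
    rcases hσ1 with h1 | h1
    · rw [hD₁, (hH1 (hσ ▸ h1)).2]
      simp only [Finset.mem_insert, Finset.mem_singleton, Set.mem_setOf_eq, exists_eq_or_imp,
        exists_eq_left, c2, c1, h1]
      have := hab x
      omega
    · rw [hD₁, (hH2 (hσ ▸ h1)).2]
      simp only [Finset.mem_insert, Finset.mem_singleton, Set.mem_setOf_eq, exists_eq_or_imp,
        exists_eq_left, c0, c1, h1]
      have := hab x
      omega
  exact comb m hm hchar hq a b hab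
    (mul_left_cancel₀ hσ0 (by rw [hS.1]; ring)) hS.2 hSab
    (fun s => mul_left_cancel₀ hσ0 (hT s).1) (fun s => (hT s).2) C₀ hC₀ D₀ D₁ hA hB
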